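/- Let δ, K₀, C₀ > 0. There do not exist a continuous function h : [0,∞) → ℝ with h(t) ≥ C₀ for all t ≥ 0 and a twice differentiable function g : [0,∞) → ℝ such that g''(t) ≤ −δ h(t) and |g'(t)| ≤ K₀ √(h(t)) for all t ≥ 0. -/

import Mathlib

open Set

/-- A function on `[a, ∞)` whose derivative is bounded below by `c` grows at least linearly
with slope `c`. -/
theorem add_mul_sub_le_of_le_hasDerivWithinAt_Ici {f f' : ℝ → ℝ} {a c : ℝ}
    (hf : ∀ t ∈ Ici a, HasDerivWithinAt f (f' t) (Ici a) t)
    (hc : ∀ t ∈ Ici a, c ≤ f' t) {t : ℝ} (ht : a ≤ t) :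
    f a + c * (t - a) ≤ f t := by
  have hd : ∀ s ∈ Ici a, HasDerivWithinAt (fun s => f s - c * s) (f' s - c * 1) (Ici a) s :=
    fun s hs => (hf s hs).sub ((hasDerivWithinAt_id s _).const_mul c)
  have hmono : MonotoneOn (fun s => f s - c * s) (Ici a) :=
    monotoneOn_of_hasDerivWithinAt_nonneg (convex_Ici a)
      (fun s hs => (hd s hs).continuousWithinAt)
      (fun s hs => (hd s (interior_subset hs)).mono interior_subset)
      (fun s hs => by linarith [hc s (interior_subset hs)])
  have h : f a - c * a ≤ f t - c * t := hmono self_mem_Ici ht ht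
  linarith

/-- Abstract core of the finite-time blow-up argument: there do not exist a
continuous function `h ≥ C₀ > 0` on `[0,∞)` and a twice differentiable `g` on `[0,∞)`
(with first and second derivatives `g'`, `g''`) such that `g'' ≤ -δ h` and
`|g'| ≤ K₀ √h` on `[0,∞)`. -/
theorem stmt4 (δ K₀ C₀ : ℝ) (hδ : 0 < δ) (hK : 0 < K₀) (hC : 0 < C₀) :
    ¬ ∃ (h g g' g'' : ℝ → ℝ),
      ContinuousOn h (Ici 0) ∧
      (∀ t ∈ Ici (0:ℝ), C₀ ≤ h t) ∧
      (∀ t ∈ Ici (0:ℝ), HasDerivWithinAt g (g' t) (Ici 0) t) ∧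
      (∀ t ∈ Ici (0:ℝ), HasDerivWithinAt g' (g'' t) (Ici 0) t) ∧
      (∀ t ∈ Ici (0:ℝ), g'' t ≤ -δ * h t) ∧
      (∀ t ∈ Ici (0:ℝ), |g' t| ≤ K₀ * Real.sqrt (h t)) := by
  rintro ⟨h, g, g', g'', -, hh, -, hg', hle, habs⟩
  have hδC : 0 < δ * C₀ := mul_pos hδ hC
  have hlin : ∀ t, 0 ≤ t → g' t ≤ g' 0 - δ * C₀ * t := by
    intro t ht
    have := add_mul_sub_le_of_le_hasDerivWithinAt_Ici (f := fun s => -g' s) (c := δ * C₀)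
      (fun s hs => (hg' s hs).neg)
      (fun s hs => by nlinarith [hle s hs, hh s hs]) ht
    linarith
  obtain ⟨T, hT, hneg⟩ : ∃ T, 0 ≤ T ∧ ∀ t ∈ Ici T, g' t < 0 := by
    refine ⟨(|g' 0| + 1) / (δ * C₀), by positivity, fun t ht => ?_⟩
    have h1 : |g' 0| + 1 ≤ t * (δ * C₀) := (div_le_iff₀ hδC).1 ht
    have h2 := hlin t (le_trans (by positivity) ht)
    linarith [le_abs_self (g' 0)]
  have hsub : Ici T ⊆ Ici (0 : ℝ) := Ici_subset_Ici.2 hT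
  have hinv : ∀ t, T ≤ t → (g' T)⁻¹ + δ / K₀ ^ 2 * (t - T) ≤ (g' t)⁻¹ := by
    intro t ht
    refine add_mul_sub_le_of_le_hasDerivWithinAt_Ici (f := fun s => (g' s)⁻¹)
      (fun s hs => ((hg' s (hsub hs)).mono hsub).fun_inv (hneg s hs).ne) (fun s hs => ?_) ht
    have hs0 := hsub hs
    have hsq : g' s ^ 2 ≤ K₀ ^ 2 * h s := by
      rw [← sq_abs, ← Real.sq_sqrt (hC.le.trans (hh s hs0)), ← mul_pow]
      exact pow_le_pow_left₀ (abs_nonneg _) (habs s hs0) 2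
    rw [div_le_div_iff₀ (by positivity) (sq_pos_of_neg (hneg s hs))]
    calc δ * g' s ^ 2 ≤ δ * (K₀ ^ 2 * h s) := by gcongr
      _ = δ * h s * K₀ ^ 2 := by ring
      _ ≤ -g'' s * K₀ ^ 2 := by gcongr; linarith [hle s hs0]
  have hc : 0 < δ / K₀ ^ 2 := by positivity
  have hTinv : (g' T)⁻¹ < 0 := inv_lt_zero.2 (hneg T self_mem_Ici)
  have hlen : 0 ≤ -(g' T)⁻¹ / (δ / K₀ ^ 2) := div_nonneg (by linarith) hc.le
  have hle' : T ≤ T + -(g' T)⁻¹ / (δ / K₀ ^ 2) := by linarith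
  have h1 := hinv _ hle'
  rw [add_sub_cancel_left, mul_div_cancel₀ _ hc.ne'] at h1
  linarith [inv_lt_zero.2 (hneg _ hle')]
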